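/- The even hyperbolic lattice I_{1,10}(2), i.e. ℤ¹¹ with bilinear form ⟨x,y⟩ = 2(x₀y₀ − x₁y₁ − ⋯ − x₁₀y₁₀) (the 2-elementary lattice with invariants (r,a,δ) = (11,11,1)), is reflective: the subgroup W_r of O(S) generated by reflections in all roots has finite index in O(S). -/

import Mathlib

open Matrix

/-- The bilinear form on `ℤⁿ` associated to a Gram matrix `G`. -/
def bform {n : ℕ} (G : Matrix (Fin n) (Fin n) ℤ) (x y : Fin n → ℤ) : ℤ :=
  x ⬝ᵥ G.mulVec y

/-- The orthogonal group `O(S)` of the lattice with Gram matrix `G`: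
all `ℤ`-module automorphisms preserving the bilinear form. -/
def OrthGroup (n : ℕ) (G : Matrix (Fin n) (Fin n) ℤ) :
    Subgroup ((Fin n → ℤ) ≃ₗ[ℤ] (Fin n → ℤ)) where
  carrier := {f | ∀ x y, bform G (f x) (f y) = bform G x y}
  one_mem' := fun _ _ => rfl
  mul_mem' := by
    intro f g hf hg x y
    exact (hf (g x) (g y)).trans (hg x y)
  inv_mem' := by
    intro f hf x y
    have h := (hf (f⁻¹ x) (f⁻¹ y)).symm
    rwa [show f (f⁻¹ x) = x from f.apply_symm_apply x,
      show f (f⁻¹ y) = y from f.apply_symm_apply y] at h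

/-- A root: a vector of square `-2`, or of square `-4` whose pairing with
the whole lattice is even. -/
def IsRoot {n : ℕ} (G : Matrix (Fin n) (Fin n) ℤ) (α : Fin n → ℤ) : Prop :=
  bform G α α = -2 ∨ (bform G α α = -4 ∧ ∀ x : Fin n → ℤ, (2 : ℤ) ∣ bform G α x)

/-- `f` is the reflection in a root `α`. -/
def IsReflection {n : ℕ} (G : Matrix (Fin n) (Fin n) ℤ)
    (f : (Fin n → ℤ) ≃ₗ[ℤ] (Fin n → ℤ)) : Prop :=
  ∃ α : Fin n → ℤ, IsRoot G α ∧
    ∀ x : Fin n → ℤ, f x = x - ((2 * bform G x α) / bform G α α) • α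

/-- The subgroup `W_r` of `O(S)` generated by the reflections in all roots. -/
def Wr (n : ℕ) (G : Matrix (Fin n) (Fin n) ℤ) : Subgroup ↥(OrthGroup n G) :=
  Subgroup.closure {f | IsReflection G f.val}

open Matrix

/-- Orthogonal direct sum of two Gram matrices. -/
def dsum {m k : ℕ} (A : Matrix (Fin m) (Fin m) ℤ) (B : Matrix (Fin k) (Fin k) ℤ) :
    Matrix (Fin (m + k)) (Fin (m + k)) ℤ :=
  Matrix.reindex finSumFinEquiv finSumFinEquiv (Matrix.fromBlocks A 0 0 B)

/-- Gram matrix of the hyperbolic plane `U`. -/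
def gramU : Matrix (Fin 2) (Fin 2) ℤ := !![0, 1; 1, 0]

/-- Gram matrix of `A₁ = ⟨-2⟩`. -/
def gramA1 : Matrix (Fin 1) (Fin 1) ℤ := !![-2]

/-- Gram matrix (= negative Cartan matrix) of a simply laced root lattice with
given Dynkin diagram edges. -/
def adjGram (n : ℕ) (E : List (ℕ × ℕ)) : Matrix (Fin n) (Fin n) ℤ :=
  Matrix.of fun i j =>
    if i = j then -2 else if (i.1, j.1) ∈ E ∨ (j.1, i.1) ∈ E then 1 else 0

/-- Gram matrix of the negative definite root lattice `Dₙ`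
(in the root basis `e₁+e₂, e₂-e₁, e₃-e₂, …, eₙ-eₙ₋₁` of `{x ∈ ℤⁿ : Σxᵢ even}`
with the negative of the standard Euclidean form). -/
def gramD (n : ℕ) : Matrix (Fin n) (Fin n) ℤ :=
  adjGram n ((0, 2) :: (List.range (n - 2)).map fun k => (k + 1, k + 2))

/-- Gram matrix (negative Cartan matrix) of `E₈`. -/
def gramE8 : Matrix (Fin 8) (Fin 8) ℤ :=
  adjGram 8 [(0, 2), (1, 3), (2, 3), (3, 4), (4, 5), (5, 6), (6, 7)]

/-- Gram matrix (negative Cartan matrix) of `E₇`. -/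
def gramE7 : Matrix (Fin 7) (Fin 7) ℤ :=
  adjGram 7 [(0, 2), (1, 3), (2, 3), (3, 4), (4, 5), (5, 6)]

/-- The Gram matrix of the even 2-elementary hyperbolic lattice `I_{1,10}(2)`,
with invariants `(r,a,δ) = (11,11,1)`. -/
def gramS :=
  Matrix.diagonal (fun i : Fin 11 => if i = 0 then (2 : ℤ) else -2)

/-- The standard form of signature `(1, 10)` on `ℤ¹¹`. -/
def lorentz (x y : Fin 11 → ℤ) : ℤ := x 0 * y 0 - ∑ i : Fin 10, x i.succ * y i.succ

theorem bform_gramS (x y : Fin 11 → ℤ) : bform gramS x y = 2 * lorentz x y := by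
  simp only [bform, gramS, lorentz, dotProduct, mulVec_diagonal, Fin.sum_univ_succ (n := 10),
    Fin.succ_ne_zero, if_true, if_false]
  rw [mul_sub, Finset.mul_sum, sub_eq_add_neg, ← Finset.sum_neg_distrib]
  congr 1
  · ring
  · exact Finset.sum_congr rfl fun i _ => by ring

theorem lorentz_comm (x y : Fin 11 → ℤ) : lorentz x y = lorentz y x := by
  simp only [lorentz, mul_comm]

theorem lorentz_add_left (x y z : Fin 11 → ℤ) :
    lorentz (x + y) z = lorentz x z + lorentz y z := by
  simp only [lorentz, Pi.add_apply, add_mul, Finset.sum_add_distrib]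
  ring

theorem lorentz_smul_left (c : ℤ) (x z : Fin 11 → ℤ) :
    lorentz (c • x) z = c * lorentz x z := by
  simp only [lorentz, Pi.smul_apply, smul_eq_mul, mul_assoc, mul_sub, Finset.mul_sum]

theorem lorentz_add_right (x y z : Fin 11 → ℤ) :
    lorentz x (y + z) = lorentz x y + lorentz x z := by
  rw [lorentz_comm, lorentz_add_left, lorentz_comm y, lorentz_comm z]

theorem lorentz_smul_right (c : ℤ) (x z : Fin 11 → ℤ) :
    lorentz x (c • z) = c * lorentz x z := by
  rw [lorentz_comm, lorentz_smul_left, lorentz_comm z]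

theorem mem_orthGroup_gramS {f : (Fin 11 → ℤ) ≃ₗ[ℤ] (Fin 11 → ℤ)} :
    f ∈ OrthGroup 11 gramS ↔ ∀ x y, lorentz (f x) (f y) = lorentz x y := by
  change (∀ x y, bform gramS (f x) (f y) = bform gramS x y) ↔ _
  simp only [bform_gramS]
  exact forall₂_congr fun x y => by constructor <;> intro h <;> linarith

/-- The transvection `x ↦ x + c ⟨x, α⟩ α`, a reflection because `c ⟨α, α⟩ = -2`. -/
def lorentzReflection (α : Fin 11 → ℤ) (c : ℤ) (h : c * lorentz α α = -2) :
    (Fin 11 → ℤ) ≃ₗ[ℤ] (Fin 11 → ℤ) :=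
  LinearEquiv.ofInvolutive
    { toFun := fun x => x + (c * lorentz x α) • α
      map_add' := fun x y => by
        rw [lorentz_add_left, mul_add, add_smul]
        abel
      map_smul' := fun a x => by
        rw [lorentz_smul_left, RingHom.id_apply, smul_add, smul_smul, mul_left_comm] }
    fun x => by
      change x + (c * lorentz x α) • α + (c * lorentz (x + (c * lorentz x α) • α) α) • α = x
      rw [add_assoc, ← add_smul, lorentz_add_left, lorentz_smul_left]
      have : c * lorentz x α + c * (lorentz x α + c * lorentz x α * lorentz α α) = 0 := by
        linear_combination c * lorentz x α * h
      rw [this, zero_smul, add_zero]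

theorem lorentzReflection_apply (α : Fin 11 → ℤ) (c : ℤ) (h : c * lorentz α α = -2)
    (x : Fin 11 → ℤ) : lorentzReflection α c h x = x + (c * lorentz x α) • α := rfl

theorem lorentzReflection_mem (α : Fin 11 → ℤ) (c : ℤ) (h : c * lorentz α α = -2) :
    lorentzReflection α c h ∈ OrthGroup 11 gramS := by
  rw [mem_orthGroup_gramS]
  intro x y
  simp only [lorentzReflection_apply, lorentz_add_left, lorentz_add_right, lorentz_smul_left,
    lorentz_smul_right, lorentz_comm α y]
  linear_combination c * lorentz x α * lorentz y α * h

theorem isReflection_lorentzReflection (α : Fin 11 → ℤ) (c : ℤ) (h : c * lorentz α α = -2)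
    (hα : lorentz α α = -1 ∨ lorentz α α = -2) :
    IsReflection gramS (lorentzReflection α c h) := by
  refine ⟨α, ?_, fun x => ?_⟩
  · unfold IsRoot
    simp only [bform_gramS, dvd_mul_right, implies_true, and_true]
    omega
  · rw [lorentzReflection_apply, sub_eq_add_neg, ← neg_smul, bform_gramS, bform_gramS]
    congr 2
    rcases hα with hα | hα <;> rw [hα] at h ⊢
    · obtain rfl : c = 2 := by omega
      omega
    · obtain rfl : c = 1 := by omega
      omega

/-- The reflection in a vector of square `-1` or `-2` moves a vector within its `W_r`-orbit. -/
theorem exists_mem_Wr_apply (α : Fin 11 → ℤ) (c : ℤ) (h : c * lorentz α α = -2)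
    (hα : lorentz α α = -1 ∨ lorentz α α = -2) :
    ∃ w ∈ Wr 11 gramS, ∀ x, w.val x = x + (c * lorentz x α) • α :=
  ⟨⟨lorentzReflection α c h, lorentzReflection_mem α c h⟩,
    Subgroup.subset_closure (isReflection_lorentzReflection α c h hα), fun _ => rfl⟩

/-- In coordinates with respect to the rays of the simplicial cone
`x₁ ≥ ⋯ ≥ x₁₀ ≥ 0`, `x₀ ≥ x₁ + x₂ + x₃`, the vectors of square `1` with
`3 x₀ ≥ x₁ + ⋯ + x₁₀` have `x₀ ≤ 3`. -/
theorem chamber_coord_bound (c0 c1 c2 c3 c4 c5 c6 c7 c8 c9 c10 : ℤ)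
    (h0 : 0 ≤ c0) (h1 : 0 ≤ c1) (h2 : 0 ≤ c2) (h3 : 0 ≤ c3) (h4 : 0 ≤ c4) (h5 : 0 ≤ c5)
    (h6 : 0 ≤ c6) (h7 : 0 ≤ c7) (h8 : 0 ≤ c8) (h9 : 0 ≤ c9) (h10 : 0 ≤ c10)
    (hL : c10 ≤ 3 * c0 + 2 * c1 + 4 * c2 + 6 * c3 + 5 * c4 + 4 * c5 + 3 * c6 + 2 * c7 + c8)
    (hQ : (c0 + c1 + 2 * c2 + 3 * (c3 + c4 + c5 + c6 + c7 + c8 + c9 + c10)) ^ 2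
      - ((c1 + c2 + c3 + c4 + c5 + c6 + c7 + c8 + c9 + c10) ^ 2
        + (c2 + c3 + c4 + c5 + c6 + c7 + c8 + c9 + c10) ^ 2
        + (c3 + c4 + c5 + c6 + c7 + c8 + c9 + c10) ^ 2
        + (c4 + c5 + c6 + c7 + c8 + c9 + c10) ^ 2
        + (c5 + c6 + c7 + c8 + c9 + c10) ^ 2
        + (c6 + c7 + c8 + c9 + c10) ^ 2 + (c7 + c8 + c9 + c10) ^ 2
        + (c8 + c9 + c10) ^ 2 + (c9 + c10) ^ 2 + c10 ^ 2) = 1) :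
    c0 + c1 + 2 * c2 + 3 * (c3 + c4 + c5 + c6 + c7 + c8 + c9 + c10) ≤ 3 := by
  obtain ⟨L, hLdef⟩ : ∃ L, L =
    3 * c0 + 2 * c1 + 4 * c2 + 6 * c3 + 5 * c4 + 4 * c5 + 3 * c6 + 2 * c7 + c8 := ⟨_, rfl⟩
  rw [← hLdef] at hL
  have hcL : 0 ≤ c10 * (2 * L - c10) := mul_nonneg h10 (by linarith)
  have hR : 0 ≤ c2 * (4 * c0 + 2 * c1 + 8 * c3 + 8 * c4 + 8 * c5 + 8 * c6 + 8 * c7 + 8 * c8 + 8 * c9)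
      + c3 * (6 * c0 + 4 * c1 + 12 * c4 + 12 * c5 + 12 * c6 + 12 * c7 + 12 * c8 + 12 * c9)
      + c4 * (6 * c0 + 4 * c1 + 10 * c5 + 10 * c6 + 10 * c7 + 10 * c8 + 10 * c9)
      + c5 * (6 * c0 + 4 * c1 + 8 * c6 + 8 * c7 + 8 * c8 + 8 * c9)
      + c6 * (6 * c0 + 4 * c1 + 6 * c7 + 6 * c8 + 6 * c9)
      + c7 * (6 * c0 + 4 * c1 + 4 * c8 + 4 * c9) := by positivity
  have hS : 0 ≤ 2 * c0 * c1 + 6 * c0 * c8 + 6 * c0 * c9 + 4 * c1 * c8 + 4 * c1 * c9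
      + 2 * c8 * c9 := by positivity
  have key : c0 ^ 2 + 2 * c2 ^ 2 + 6 * c3 ^ 2 + 5 * c4 ^ 2 + 4 * c5 ^ 2 + 3 * c6 ^ 2
      + 2 * c7 ^ 2 + c8 ^ 2 ≤ 1 := by
    subst hLdef
    linarith
  have hzero (c : ℤ) (hc : 2 * c ^ 2 ≤ 1) : c = 0 := by
    rw [← sq_eq_zero_iff]
    linarith [sq_nonneg c, show c ^ 2 < 1 by omega]
  have s0 := sq_nonneg c0
  have s2 := sq_nonneg c2
  have s3 := sq_nonneg c3
  have s4 := sq_nonneg c4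
  have s5 := sq_nonneg c5
  have s6 := sq_nonneg c6
  have s7 := sq_nonneg c7
  have s8 := sq_nonneg c8
  have z2 : c2 = 0 := hzero _ (by linarith)
  have z3 : c3 = 0 := hzero _ (by linarith)
  have z4 : c4 = 0 := hzero _ (by linarith)
  have z5 : c5 = 0 := hzero _ (by linarith)
  have z6 : c6 = 0 := hzero _ (by linarith)
  have z7 : c7 = 0 := hzero _ (by linarith)
  have z0 : c0 ≤ 1 := (le_abs_self c0).trans (sq_le_one_iff_abs_le_one c0 |>.1 (by linarith))
  have z8 : c8 ≤ 1 := (le_abs_self c8).trans (sq_le_one_iff_abs_le_one c8 |>.1 (by linarith))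
  clear hR hS key hcL s0 s2 s3 s4 s5 s6 s7 s8
  subst z2 z3 z4 z5 z6 z7
  obtain rfl | rfl : c0 = 0 ∨ c0 = 1 := by omega
  · obtain rfl | rfl : c8 = 0 ∨ c8 = 1 := by omega
    · have hc : 4 * (c1 * c9) + c10 * (4 * c1 - c10) = 1 := by linear_combination hQ
      rcases h10.eq_or_lt with rfl | h10
      · omega
      · nlinarith [mul_nonneg h1 h9]
    · have hc : 4 * c1 + 4 * (c1 * c9) + 2 * c9 + c10 * (4 * c1 + 2 - c10) = 0 := by
        linear_combination hQ
      have h19 := mul_nonneg h1 h9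
      have h2 : 0 ≤ c10 * (4 * c1 + 2 - c10) := mul_nonneg h10 (by linarith)
      obtain rfl : c1 = 0 := by linarith
      obtain rfl : c9 = 0 := by linarith
      nlinarith
  · have hc : c8 ^ 2 + 2 * c1 + 6 * c8 + 6 * c9 + 4 * (c1 * c8) + 4 * (c1 * c9) + 2 * (c8 * c9)
        + c10 * (6 + 4 * c1 + 2 * c8 - c10) = 0 := by linear_combination hQ
    have h18 := mul_nonneg h1 h8
    have h19 := mul_nonneg h1 h9
    have h89 := mul_nonneg h8 h9
    have h2 : 0 ≤ c10 * (6 + 4 * c1 + 2 * c8 - c10) := mul_nonneg h10 (by linarith)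
    have h88 := sq_nonneg c8
    obtain rfl : c1 = 0 := by linarith
    obtain rfl : c8 = 0 := by linarith
    obtain rfl : c9 = 0 := by linarith
    nlinarith

theorem chamber_bound (a : ℤ) (y : Fin 10 → ℤ) (hy : ∀ i, 0 ≤ y i)
    (hQ : a ^ 2 - ∑ i, y i ^ 2 = 1)
    (h3 : ∀ i j k, i ≠ j → i ≠ k → j ≠ k → y i + y j + y k ≤ a)
    (hs : ∑ i, y i ≤ 3 * a) : a ≤ 3 := by
  set σ := Tuple.sort y
  have hm : Monotone (y ∘ σ) := Tuple.monotone_sort y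
  have hle (i j : Fin 10) (hij : i ≤ j) : 0 ≤ y (σ j) - y (σ i) := sub_nonneg.2 (hm hij)
  have ht := h3 (σ 9) (σ 8) (σ 7) (by simp) (by simp) (by simp)
  rw [← Equiv.sum_comp σ] at hQ hs
  simp only [Fin.sum_univ_succ, Fin.sum_univ_zero] at hQ hs
  have := chamber_coord_bound (a - (y (σ 9) + y (σ 8) + y (σ 7)))
    (y (σ 9) - y (σ 8)) (y (σ 8) - y (σ 7)) (y (σ 7) - y (σ 6)) (y (σ 6) - y (σ 5))
    (y (σ 5) - y (σ 4)) (y (σ 4) - y (σ 3)) (y (σ 3) - y (σ 2)) (y (σ 2) - y (σ 1))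
    (y (σ 1) - y (σ 0)) (y (σ 0)) (by linarith)
    (hle _ _ (by decide)) (hle _ _ (by decide)) (hle _ _ (by decide)) (hle _ _ (by decide))
    (hle _ _ (by decide)) (hle _ _ (by decide)) (hle _ _ (by decide)) (hle _ _ (by decide))
    (hle _ _ (by decide)) (hy _)
    (by simp at hs; linarith)
    (by simp at hQ; linear_combination hQ)
  linarith

/-- A root `α` with `⟨x, α⟩ = α₀ x₀ - s` shortens the `0`-th coordinate of `x` when `s` is
larger than `α₀ x₀` but not too large. -/
theorem exists_mem_Wr_natAbs_lt (x : Fin 11 → ℤ) (c k : ℤ) (ε : Fin 11 → ℤ) (T : Fin 10 → ℤ)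
    (hε : ∀ i, ε i * x i = |x i|) (hε2 : ∀ i, ε i * ε i = 1)
    (hc : c * (k ^ 2 - ∑ i, T i ^ 2) = -2)
    (hk : k ^ 2 - ∑ i, T i ^ 2 = -1 ∨ k ^ 2 - ∑ i, T i ^ 2 = -2) (hk0 : 0 < k) (hc0 : 0 < c)
    (hlt : k * |x 0| < ∑ i, T i * |x i.succ|)
    (hgt : c * k * (∑ i, T i * |x i.succ|) < (2 + c * k * k) * |x 0|) :
    ∃ w ∈ Wr 11 gramS, (w.val x 0).natAbs < (x 0).natAbs := by
  set α : Fin 11 → ℤ := Fin.cons (k * ε 0) fun i => T i * ε i.succ with hα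
  have hαα : lorentz α α = k ^ 2 - ∑ i, T i ^ 2 := by
    simp only [lorentz, hα, Fin.cons_zero, Fin.cons_succ]
    congr 1
    · linear_combination k ^ 2 * hε2 0
    · exact Finset.sum_congr rfl fun i _ => by linear_combination T i ^ 2 * hε2 i.succ
  have hxα : lorentz x α = k * |x 0| - ∑ i, T i * |x i.succ| := by
    simp only [lorentz, hα, Fin.cons_zero, Fin.cons_succ]
    congr 1
    · linear_combination k * hε 0
    · exact Finset.sum_congr rfl fun i _ => by linear_combination T i * hε i.succ
  obtain ⟨w, hw, hwx⟩ := exists_mem_Wr_apply α c (by rw [hαα, hc]) (by rwa [hαα])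
  refine ⟨w, hw, ?_⟩
  have hx0 : x 0 = ε 0 * |x 0| := by linear_combination ε 0 * hε 0 - x 0 * hε2 0
  set s := ∑ i, T i * |x i.succ|
  have hval : w.val x 0 = ε 0 * (|x 0| + c * k * (k * |x 0| - s)) := by
    rw [hwx, hxα, Pi.add_apply, Pi.smul_apply, smul_eq_mul, hα, Fin.cons_zero]
    linear_combination hx0
  have hε1 : |ε 0| = 1 := by
    have := hε2 0
    rcases mul_self_eq_one_iff.1 this with h | h <;> simp [h]
  have hck : 0 < c * k := mul_pos hc0 hk0
  zify
  rw [hval, abs_mul, hε1, one_mul, abs_lt]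
  constructor
  · linarith
  · nlinarith

theorem exists_mem_Wr_natAbs_le_three (x : Fin 11 → ℤ) (hx : lorentz x x = 1) :
    ∃ w ∈ Wr 11 gramS, (w.val x 0).natAbs ≤ 3 := by
  induction hn : (x 0).natAbs using Nat.strong_induction_on generalizing x with
  | _ n ih =>
  subst hn
  by_cases hred : ∃ w ∈ Wr 11 gramS, (w.val x 0).natAbs < (x 0).natAbs
  · obtain ⟨w, hw, hlt⟩ := hred
    obtain ⟨v, hv, hle⟩ := ih _ hlt (w.val x)
      (by rw [mem_orthGroup_gramS.1 w.2, hx]) rfl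
    exact ⟨v * w, mul_mem hv hw, hle⟩
  refine ⟨1, one_mem _, ?_⟩
  change (x 0).natAbs ≤ 3
  have hQ : |x 0| ^ 2 - ∑ i : Fin 10, |x i.succ| ^ 2 = 1 := by
    simpa only [sq_abs, ← pow_two, lorentz] using hx
  have ha : 0 < |x 0| := by
    have : 0 ≤ ∑ i : Fin 10, |x i.succ| ^ 2 := Finset.sum_nonneg fun i _ => sq_nonneg _
    have := abs_nonneg (x 0)
    nlinarith
  obtain ⟨ε, hε, hε2⟩ : ∃ ε : Fin 11 → ℤ, (∀ i, ε i * x i = |x i|) ∧ ∀ i, ε i * ε i = 1 := by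
    refine ⟨fun i => if 0 ≤ x i then 1 else -1, fun i => ?_, fun i => ?_⟩ <;> dsimp only <;> split
    · rw [abs_of_nonneg ‹_›, one_mul]
    · rw [abs_of_neg (not_le.1 ‹_›), neg_one_mul]
    · rfl
    · rfl
  zify
  refine chamber_bound |x 0| (fun i => |x i.succ|) (fun i => abs_nonneg _) hQ ?_ ?_
  · intro i j k hij hik hjk
    by_contra! hlt
    set T : Fin 10 → ℤ := fun m => if m ∈ ({i, j, k} : Finset (Fin 10)) then 1 else 0 with hT
    have hsum (f : Fin 10 → ℤ) : ∑ m, T m * f m = f i + f j + f k := by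
      simp only [hT, ite_mul, one_mul, zero_mul, Finset.sum_ite_mem, Finset.univ_inter]
      rw [Finset.sum_insert (by simp [hij, hik]), Finset.sum_pair hjk, add_assoc]
    have hTT : ∑ m, T m ^ 2 = 3 := by
      simp only [pow_two, hsum]
      simp [hT]
    have hle : |x i.succ| ^ 2 + |x j.succ| ^ 2 + |x k.succ| ^ 2 ≤ |x 0| ^ 2 - 1 := by
      rw [← hsum fun m => |x m.succ| ^ 2, ← hQ, sub_sub_cancel]
      refine Finset.sum_le_sum fun m _ => ?_
      have := sq_nonneg |x m.succ|
      simp only [hT]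
      split <;> linarith
    refine hred (exists_mem_Wr_natAbs_lt x 1 1 ε T hε hε2 (by rw [hTT]; norm_num)
      (by rw [hTT]; norm_num) one_pos one_pos ?_ ?_)
    · rw [hsum, one_mul]
      exact hlt
    · rw [hsum]
      nlinarith [sq_nonneg (|x i.succ| - |x j.succ|), sq_nonneg (|x i.succ| - |x k.succ|),
        sq_nonneg (|x j.succ| - |x k.succ|)]
  · by_contra! hlt
    have hcs : (∑ i : Fin 10, |x i.succ|) ^ 2 ≤ 10 * ∑ i : Fin 10, |x i.succ| ^ 2 := by
      simpa using sq_sum_le_card_mul_sum_sq (s := Finset.univ) (f := fun i : Fin 10 => |x i.succ|)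
    refine hred (exists_mem_Wr_natAbs_lt x 2 3 ε (fun _ => 1) hε hε2 (by norm_num)
      (by norm_num) (by norm_num) (by norm_num) ?_ ?_)
    · simpa using hlt
    · simp only [one_mul]
      nlinarith

/-- An isometry moving `e₀` to a vector with small `0`-th coordinate has small entries. -/
theorem abs_apply_single_le_three (g : OrthGroup 11 gramS)
    (hg : (g.val (Pi.single 0 1) 0).natAbs ≤ 3) (i j : Fin 11) :
    |g.val (Pi.single i 1) j| ≤ 3 := by
  have hg' := mem_orthGroup_gramS.1 g.2
  set v := g.val (Pi.single 0 1) with hv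
  have hvv : lorentz v v = 1 := by
    rw [hv, hg']
    simp [lorentz]
  have hv0 : v 0 ^ 2 ≤ 9 := by
    have : |v 0| ≤ 3 := by zify at hg; exact hg
    have := sq_le_sq' (neg_le_of_abs_le this) (le_of_abs_le this)
    linarith
  have bound (u : Fin 11 → ℤ) (hu : u 0 ^ 2 ≤ 9) (hu2 : ∑ m : Fin 10, u m.succ ^ 2 ≤ 9) :
      |u j| ≤ 3 := by
    refine abs_le_of_sq_le_sq (b := 3) ?_ (by norm_num)
    refine Fin.cases (by linarith) (fun m => ?_) j
    have := Finset.single_le_sum (f := fun m : Fin 10 => u m.succ ^ 2)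
      (fun _ _ => sq_nonneg _) (Finset.mem_univ m)
    linarith
  have self_eq (u : Fin 11 → ℤ) : ∑ m : Fin 10, u m.succ ^ 2 = u 0 ^ 2 - lorentz u u := by
    simp only [lorentz, pow_two, sub_sub_cancel]
  have hvs := self_eq v
  rw [hvv] at hvs
  refine Fin.cases ?_ (fun i => ?_) i
  · exact bound v hv0 (by linarith)
  · set u := g.val (Pi.single i.succ 1) with hu
    have huu : lorentz u u = -1 := by
      rw [hu, hg']
      simp [lorentz, Pi.single_apply]
    have huv : lorentz u v = 0 := by
      rw [hu, hv, hg']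
      simp [lorentz, Pi.single_apply]
    have hus := self_eq u
    rw [huu] at hus
    have hcs := Finset.sum_mul_sq_le_sq_mul_sq Finset.univ
      (fun m : Fin 10 => u m.succ) (fun m => v m.succ)
    rw [hus, hvs, ← sub_eq_zero.1 huv] at hcs
    have : u 0 ^ 2 ≤ 8 := by nlinarith
    exact bound u (by linarith) (by linarith)

theorem finite_setOf_natAbs_apply_le_three :
    {g : OrthGroup 11 gramS | (g.val (Pi.single 0 1) 0).natAbs ≤ 3}.Finite := by
  refine Set.Finite.of_finite_image (f := fun g i j => g.val (Pi.single i 1) j) ?_ ?_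
  · refine (Set.finite_Icc (fun _ _ => -3 : Fin 11 → Fin 11 → ℤ) fun _ _ => 3).subset ?_
    rintro _ ⟨g, hg, rfl⟩
    exact ⟨fun i j => (abs_le.1 (abs_apply_single_le_three g hg i j)).1,
      fun i j => (abs_le.1 (abs_apply_single_le_three g hg i j)).2⟩
  · intro g _ h _ hgh
    apply Subtype.ext
    apply LinearEquiv.toLinearMap_injective
    refine (Pi.basisFun ℤ (Fin 11)).ext fun i => ?_
    simpa using congrFun hgh i

/-- The lattice `I_{1,10}(2)` is reflective: the subgroup `W_r` of `O(S)`
generated by the reflections in all roots has finite index in `O(S)`. -/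
theorem reflective_11_11_1 : (Wr _ gramS).FiniteIndex := by
  have hfin := finite_setOf_natAbs_apply_le_three.to_subtype
  have : Finite (OrthGroup 11 gramS ⧸ Wr 11 gramS) := by
    refine Finite.of_surjective
      (fun g : {g : OrthGroup 11 gramS | (g.val (Pi.single 0 1) 0).natAbs ≤ 3} =>
        ((g.1⁻¹ : OrthGroup 11 gramS) : OrthGroup 11 gramS ⧸ Wr 11 gramS)) fun q => ?_
    obtain ⟨g, rfl⟩ := QuotientGroup.mk_surjective q
    obtain ⟨w, hw, hle⟩ := exists_mem_Wr_natAbs_le_three ((g⁻¹).val (Pi.single 0 1)) (by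
      rw [mem_orthGroup_gramS.1 (g⁻¹).2]
      simp [lorentz])
    refine ⟨⟨w * g⁻¹, hle⟩, ?_⟩
    rw [QuotientGroup.eq]
    simpa using hw
  exact Subgroup.finiteIndex_of_finite_quotient
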